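/- Let λ, β ∈ ℝ with λβ > 0, and let a, b, r, μ ∈ ℝ. Consider the ODE u'(x) = λ(βx·u(x) − μ + r·(a·x² + b)). Then: (i) the linear function u₀(x) := −(ra/β)·x is a solution if and only if μ = rb + ra/(λβ); (ii) any two solutions differ by a constant multiple of e^{λβx²/2}; (iii) if u is a solution with e^{−λβx²/2}·u(x) → 0 both as x → +∞ and as x → −∞, then necessarily μ = rb + ra/(λβ) and u = u₀. -/

import Mathlib

open Filter Topology

theorem Monotone.eq_of_tendsto_atTop_atBot {α β : Type*} [TopologicalSpace α] [PartialOrder α]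
    [OrderClosedTopology α] [Nonempty β] [Lattice β] {f : β → α} {c : α}
    (hf : Monotone f) (htop : Tendsto f atTop (𝓝 c)) (hbot : Tendsto f atBot (𝓝 c)) (x : β) :
    f x = c :=
  le_antisymm (hf.ge_of_tendsto htop x) (hf.le_of_tendsto hbot x)

theorem eq_of_hasDerivAt_nonneg_of_tendsto {f f' : ℝ → ℝ} {c : ℝ}
    (hf : ∀ x, HasDerivAt f (f' x) x) (hf' : ∀ x, 0 ≤ f' x)
    (htop : Tendsto f atTop (𝓝 c)) (hbot : Tendsto f atBot (𝓝 c)) (x : ℝ) : f x = c :=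
  (monotone_of_hasDerivAt_nonneg hf hf').eq_of_tendsto_atTop_atBot htop hbot x

theorem tendsto_id_mul_exp_neg_mul_sq_cocompact {k : ℝ} (hk : 0 < k) :
    Tendsto (fun x : ℝ => x * Real.exp (-k * x ^ 2)) (cocompact ℝ) (𝓝 0) := by
  refine (tendsto_zero_iff_abs_tendsto_zero _).2 ?_
  refine (tendsto_rpow_abs_mul_exp_neg_mul_sq_cocompact hk 1).congr fun x => ?_
  simp [abs_mul]

/-- The integrating factor `e^{-kx²/2}` turns `w' = k x w + m` into `(e^{-kx²/2} w)' = m e^{-kx²/2}`. -/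
theorem HasDerivAt.exp_neg_sq_mul {w : ℝ → ℝ} {k m x : ℝ}
    (hw : HasDerivAt w (k * x * w x + m) x) :
    HasDerivAt (fun y => Real.exp (-(k * y ^ 2 / 2)) * w y)
      (m * Real.exp (-(k * x ^ 2 / 2))) x := by
  have h : HasDerivAt (fun y : ℝ => -(k * y ^ 2 / 2)) (-(k * x)) x := by
    refine ((((hasDerivAt_id' x).pow 2).const_mul k).div_const 2).neg.congr_deriv ?_
    norm_num; ring
  exact (h.exp.mul hw).congr_deriv (by ring)

theorem exists_eq_const_mul_exp_sq {w : ℝ → ℝ} {k : ℝ}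
    (hw : ∀ x, HasDerivAt w (k * x * w x) x) :
    ∃ c : ℝ, ∀ x, w x = c * Real.exp (k * x ^ 2 / 2) := by
  have hF (x : ℝ) : HasDerivAt (fun y => Real.exp (-(k * y ^ 2 / 2)) * w y) 0 x := by
    simpa using HasDerivAt.exp_neg_sq_mul (m := 0) (by simpa using hw x)
  refine ⟨w 0, fun x => ?_⟩
  have h := is_const_of_deriv_eq_zero (fun y => (hF y).differentiableAt) (fun y => (hF y).deriv) x 0
  simp only [Real.exp_neg] at h
  field_simp at h
  simpa [mul_comm] using h

/-- A solution of `w' = k x w + m` that is `o(e^{kx²/2})` in both directions vanishes,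
and then so does `m`. -/
theorem eq_zero_of_tendsto_exp_neg_sq_mul {w : ℝ → ℝ} {k m : ℝ}
    (hw : ∀ x, HasDerivAt w (k * x * w x + m) x)
    (htop : Tendsto (fun x => Real.exp (-(k * x ^ 2 / 2)) * w x) atTop (𝓝 0))
    (hbot : Tendsto (fun x => Real.exp (-(k * x ^ 2 / 2)) * w x) atBot (𝓝 0)) :
    m = 0 ∧ ∀ x, w x = 0 := by
  have hF (x : ℝ) := (hw x).exp_neg_sq_mul
  have hzero : ∀ x, Real.exp (-(k * x ^ 2 / 2)) * w x = 0 := by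
    rcases le_total 0 m with hm | hm
    · exact eq_of_hasDerivAt_nonneg_of_tendsto hF (fun x => by positivity) htop hbot
    · intro x
      refine neg_eq_zero.1 (eq_of_hasDerivAt_nonneg_of_tendsto (fun x => (hF x).fun_neg)
        (fun x => ?_) (by simpa using htop.neg) (by simpa using hbot.neg) x)
      exact neg_nonneg.2 (mul_nonpos_of_nonpos_of_nonneg hm (Real.exp_pos _).le)
  have hw0 (x : ℝ) : w x = 0 := (mul_eq_zero.1 (hzero x)).resolve_left (Real.exp_ne_zero _)
  refine ⟨?_, hw0⟩
  obtain rfl : w = fun _ => 0 := funext hw0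
  simpa using (hw 0).unique (hasDerivAt_const 0 0)

/-- Lemma 6.3: for the inhomogeneous variational equation
`u' = λ(βxu − μ + r(ax² + b))` with `λβ > 0`:
(i) `u₀(x) = −(ra/β)x` is a solution iff `μ = rb + ra/(λβ)`;
(ii) any two solutions differ by a constant multiple of `e^{λβx²/2}`;
(iii) any solution with sub-Gaussian growth in both directions forces
`μ = rb + ra/(λβ)` and equals `u₀`. -/
theorem variational_equation_algebraic_solution
    (l β a b r μ : ℝ) (hlβ : 0 < l * β) :
    ((∀ x : ℝ, HasDerivAt (fun x' : ℝ => -(r * a / β) * x')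
        (l * (β * x * (-(r * a / β) * x) - μ + r * (a * x ^ 2 + b))) x)
      ↔ μ = r * b + r * a / (l * β)) ∧
    (∀ u v : ℝ → ℝ,
      (∀ x : ℝ, HasDerivAt u (l * (β * x * u x - μ + r * (a * x ^ 2 + b))) x) →
      (∀ x : ℝ, HasDerivAt v (l * (β * x * v x - μ + r * (a * x ^ 2 + b))) x) →
      ∃ c : ℝ, ∀ x : ℝ, u x - v x = c * Real.exp (l * β * x ^ 2 / 2)) ∧
    (∀ u : ℝ → ℝ,
      (∀ x : ℝ, HasDerivAt u (l * (β * x * u x - μ + r * (a * x ^ 2 + b))) x) →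
      Filter.Tendsto (fun x : ℝ => Real.exp (-(l * β * x ^ 2 / 2)) * u x)
        Filter.atTop (nhds 0) →
      Filter.Tendsto (fun x : ℝ => Real.exp (-(l * β * x ^ 2 / 2)) * u x)
        Filter.atBot (nhds 0) →
      (μ = r * b + r * a / (l * β) ∧ ∀ x : ℝ, u x = -(r * a / β) * x)) := by
  have hl : l ≠ 0 := left_ne_zero_of_mul hlβ.ne'
  have hβ : β ≠ 0 := right_ne_zero_of_mul hlβ.ne'
  have hlin (x : ℝ) : HasDerivAt (fun x' : ℝ => -(r * a / β) * x') (-(r * a / β)) x := by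
    simpa using (hasDerivAt_id' x).const_mul (-(r * a / β))
  refine ⟨⟨fun h => ?_, ?_⟩, fun u v hu hv => ?_, fun u hu htop hbot => ?_⟩
  · have h0 := (h 0).unique (hlin 0)
    field_simp at h0 ⊢
    linear_combination -h0
  · rintro rfl x
    refine (hlin x).congr_deriv ?_
    field_simp
    ring
  · exact exists_eq_const_mul_exp_sq (w := fun x => u x - v x) fun x =>
      ((hu x).sub (hv x)).congr_deriv (by ring)
  · have hw (x : ℝ) : HasDerivAt (fun y => u y - -(r * a / β) * y)
        (l * β * x * (u x - -(r * a / β) * x) + (l * (r * b - μ) + r * a / β)) x := by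
      refine ((hu x).sub (hlin x)).congr_deriv ?_
      field_simp
      ring
    have hgauss : Tendsto (fun x : ℝ => Real.exp (-(l * β * x ^ 2 / 2)) * (-(r * a / β) * x))
        (cocompact ℝ) (𝓝 0) := by
      have h := (tendsto_id_mul_exp_neg_mul_sq_cocompact (half_pos hlβ)).const_mul (-(r * a / β))
      rw [mul_zero] at h
      refine h.congr fun x => ?_
      rw [show -(l * β / 2) * x ^ 2 = -(l * β * x ^ 2 / 2) by ring]
      ring
    obtain ⟨hm, hu0⟩ := eq_zero_of_tendsto_exp_neg_sq_mul hw
      (by simpa only [mul_sub, sub_zero] using htop.sub (hgauss.mono_left atTop_le_cocompact))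
      (by simpa only [mul_sub, sub_zero] using hbot.sub (hgauss.mono_left atBot_le_cocompact))
    refine ⟨?_, fun x => sub_eq_zero.1 (hu0 x)⟩
    field_simp at hm ⊢
    linear_combination -hm
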